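/- Let K be a field with at least three elements and n ≥ 3. Let V be a linear subspace of M_n(K) of dimension n(n-1)/2 which acts totally intransitively on K^n, i.e. {MX : M ∈ V} ≠ K^n for every X ∈ K^n. If there exists a linear subspace H of V with dim H = dim V − 1 and H ⊆ Alt_n(K), then V = Alt_n(K). -/

import Mathlib

open Matrix

/-- The set of alternate matrices: those `A` with `Xᵀ A X = 0` for all `X`. -/
def altSet (K : Type*) [Field K] (n : ℕ) : Set (Matrix (Fin n) (Fin n) K) :=
  {A | ∀ X : Fin n → K, X ⬝ᵥ A.mulVec X = 0}

/-- The alternate matrices as a linear subspace. -/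
def altSubmodule (K : Type*) [Field K] (n : ℕ) : Submodule K (Matrix (Fin n) (Fin n) K) where
  carrier := altSet K n
  zero_mem' := fun X => by simp
  add_mem' := fun {A B} hA hB X => by
    rw [add_mulVec, dotProduct_add, hA X, hB X, add_zero]
  smul_mem' := fun c A hA X => by
    rw [smul_mulVec, dotProduct_smul, hA X, smul_zero]

theorem altSet_apply_self {K : Type*} [Field K] {n : ℕ} {A : Matrix (Fin n) (Fin n) K}
    (hA : A ∈ altSet K n) (i : Fin n) : A i i = 0 := by
  simpa using hA (Pi.single i 1)

theorem altSet_apply_swap {K : Type*} [Field K] {n : ℕ} {A : Matrix (Fin n) (Fin n) K}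
    (hA : A ∈ altSet K n) (i j : Fin n) : A i j = -A j i := by
  have h := hA (Pi.single i 1 + Pi.single j 1)
  simp [mulVec_add, altSet_apply_self hA] at h
  linear_combination h

theorem finrank_altSubmodule_le (K : Type*) [Field K] (n : ℕ) :
    Module.finrank K (altSubmodule K n) ≤ n * (n - 1) / 2 := by
  let f : altSubmodule K n →ₗ[K] ((Σ i : Fin n, Fin i) → K) :=
    { toFun := fun A p => A.1 p.1 (Fin.castLE p.1.2.le p.2)
      map_add' := fun _ _ => rfl
      map_smul' := fun _ _ => rfl }
  have hf : Function.Injective f := by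
    rw [injective_iff_map_eq_zero]
    rintro ⟨A, hA⟩ h
    have lower : ∀ i j : Fin n, j < i → A i j = 0 := fun i j hij =>
      congrFun h ⟨i, ⟨j, hij⟩⟩
    ext i j
    rcases lt_trichotomy i j with hij | rfl | hij
    · simpa [lower j i hij] using altSet_apply_swap hA i j
    · exact altSet_apply_self hA i
    · exact lower i j hij
  have h := LinearMap.finrank_le_finrank_of_injective hf
  simp only [Module.finrank_fintype_fun_eq_card, Fintype.card_sigma, Fintype.card_fin] at h
  rwa [Fin.sum_univ_eq_sum_range (fun i => i) n, Finset.sum_range_id] at h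

theorem exists_dotProduct_eq_one_of_notMem {K ι : Type*} [Field K] [Fintype ι]
    {W : Submodule K (ι → K)} {x : ι → K} (hx : x ∉ W) :
    ∃ v : ι → K, (∀ w ∈ W, w ⬝ᵥ v = 0) ∧ x ⬝ᵥ v = 1 := by
  classical
  obtain ⟨f, hfx, hfW⟩ := Submodule.exists_dual_map_eq_bot_of_notMem hx inferInstance
  obtain ⟨v, rfl⟩ := (dotProductEquiv K ι).surjective f
  refine ⟨(v ⬝ᵥ x)⁻¹ • v, fun w hw => ?_, ?_⟩
  · have : v ⬝ᵥ w = 0 :=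
      (Submodule.mem_bot K).1 (hfW ▸ Submodule.mem_map_of_mem hw)
    rw [dotProduct_smul, dotProduct_comm w v, this, smul_zero]
  · rw [dotProduct_smul, dotProduct_comm x v]
    exact inv_mul_cancel₀ hfx

theorem dotProduct_vecMulVec_sub_mulVec {K ι : Type*} [Field K] [Fintype ι] (u v x y : ι → K) :
    y ⬝ᵥ (vecMulVec u v - vecMulVec v u) *ᵥ x =
      (y ⬝ᵥ u) * (x ⬝ᵥ v) - (y ⬝ᵥ v) * (x ⬝ᵥ u) := by
  simp [sub_mulVec, vecMulVec_mulVec, dotProduct_comm _ x, mul_comm]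

theorem vecMulVec_sub_mem_altSet {K : Type*} [Field K] {n : ℕ} (u v : Fin n → K) :
    vecMulVec u v - vecMulVec v u ∈ altSet K n := fun x => by
  rw [dotProduct_vecMulVec_sub_mulVec]; ring

/-- If `Vx ≠ K^n` and some `M ∈ V` has `xᵀMx ≠ 0`, then `Vx` is annihilated by a vector
outside the line of `x`. -/
theorem exists_notMem_span_dotProduct_mulVec_eq_zero {K ι : Type*} [Field K] [Fintype ι]
    {V : Submodule K (Matrix ι ι K)} {M : Matrix ι ι K} (hM : M ∈ V) {x : ι → K}
    (hx : (fun N : Matrix ι ι K => N *ᵥ x) '' V ≠ Set.univ) (hMx : x ⬝ᵥ M *ᵥ x ≠ 0) :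
    ∃ y, y ∉ Submodule.span K {x} ∧ ∀ N ∈ V, y ⬝ᵥ N *ᵥ x = 0 := by
  obtain ⟨z, hz⟩ := (Set.ne_univ_iff_exists_notMem _).1 hx
  have hz' : z ∉ V.map ((mulVecBilin K K).flip x) := hz
  obtain ⟨y, hy, hyz⟩ := exists_dotProduct_eq_one_of_notMem hz'
  have hyV : ∀ N ∈ V, y ⬝ᵥ N *ᵥ x = 0 := fun N hN => by
    rw [dotProduct_comm]
    exact hy _ (Submodule.mem_map_of_mem (f := (mulVecBilin K K).flip x) hN)
  refine ⟨y, fun h => ?_, hyV⟩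
  obtain ⟨c, rfl⟩ := Submodule.mem_span_singleton.1 h
  have h := hyV M hM
  rw [smul_dotProduct, smul_eq_mul] at h
  rcases mul_eq_zero.1 h with rfl | h
  · simp at hyz
  · exact hMx h

/-- A quadratic form vanishing outside a proper subspace vanishes, as soon as the field has
at least three elements. -/
theorem dotProduct_mulVec_self_eq_zero_of_notMem {K ι : Type*} [Field K] [Fintype ι]
    (hK : 3 ≤ Cardinal.mk K) {P : Submodule K (ι → K)} (hP : P ≠ ⊤) {M : Matrix ι ι K}
    (h : ∀ x ∉ P, x ⬝ᵥ M *ᵥ x = 0) (x : ι → K) : x ⬝ᵥ M *ᵥ x = 0 := by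
  by_cases hx : x ∈ P
  · obtain ⟨z, -, hz⟩ := SetLike.exists_of_lt hP.lt_top
    obtain ⟨t, ht0, ht1⟩ : ∃ t : K, t ≠ 0 ∧ t ≠ 1 :=
      Cardinal.exists_ne_ne_of_three_le hK 0 1
    have key : ∀ s : K, s ≠ 0 → (x + s • z) ⬝ᵥ M *ᵥ (x + s • z) = 0 := fun s hs =>
      h _ fun hmem => hz ((P.smul_mem_iff hs).1 ((P.add_mem_iff_right hx).1 hmem))
    have hzz := h z hz
    have h1 := key 1 one_ne_zero
    have h2 := key t ht0
    simp only [mulVec_add, mulVec_smul, add_dotProduct, dotProduct_add, smul_dotProduct,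
      dotProduct_smul, hzz, smul_eq_mul] at h1 h2
    refine (mul_eq_zero.1 ?_).resolve_left (sub_ne_zero.2 ht1)
    linear_combination t * h1 - h2
  · exact h x hx

/-- Let `|K| ≥ 3` and `n ≥ 3`.  Let `V` be an `n(n-1)/2`-dimensional linear subspace of
`M_n(K)` acting totally intransitively on `K^n`.  If some hyperplane `H` of `V` consists
of alternate matrices, then `V = Alt_n(K)`. -/
theorem eq_alt_of_hyperplane_alternate (K : Type*) [Field K] (hK : 3 ≤ Cardinal.mk K)
    (n : ℕ) (hn : 3 ≤ n) (V : Submodule K (Matrix (Fin n) (Fin n) K))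
    (hdim : Module.finrank K V = n * (n - 1) / 2)
    (hti : ∀ X : Fin n → K, (fun M : Matrix (Fin n) (Fin n) K => M.mulVec X) '' V ≠ Set.univ)
    (H : Submodule K (Matrix (Fin n) (Fin n) K)) (hHV : H ≤ V)
    (hH : Module.finrank K H = Module.finrank K V - 1)
    (hHalt : (H : Set (Matrix (Fin n) (Fin n) K)) ⊆ altSet K n) :
    (V : Set (Matrix (Fin n) (Fin n) K)) = altSet K n := by
  have hAlt := finrank_altSubmodule_le K n
  suffices hV : V ≤ altSubmodule K n from
    congrArg SetLike.coe (Submodule.eq_of_le_of_finrank_le hV (hdim ▸ hAlt))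
  intro M hM
  by_contra hMalt
  obtain ⟨x₀, hx₀⟩ : ∃ x, x ⬝ᵥ M *ᵥ x ≠ 0 := not_forall.1 hMalt
  obtain ⟨y₀, hy₀, hyV₀⟩ := exists_notMem_span_dotProduct_mulVec_eq_zero hM (hti x₀) hx₀
  let φ : Matrix (Fin n) (Fin n) K →ₗ[K] K :=
    (dotProductBilin K K y₀).comp ((mulVecBilin K K).flip x₀)
  have hle : H ≤ altSubmodule K n ⊓ LinearMap.ker φ := fun A hA =>
    ⟨hHalt hA, hyV₀ A (hHV hA)⟩
  have hlt : altSubmodule K n ⊓ LinearMap.ker φ < altSubmodule K n := by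
    refine inf_le_left.lt_of_ne fun heq => ?_
    obtain ⟨u, hu, huy⟩ := exists_dotProduct_eq_one_of_notMem hy₀
    obtain ⟨v, -, hv⟩ := exists_dotProduct_eq_one_of_notMem (W := ⊥) (x := x₀)
      (by rintro (rfl : x₀ = 0); simp at hx₀)
    have hmem : vecMulVec u v - vecMulVec v u ∈ altSubmodule K n :=
      vecMulVec_sub_mem_altSet u v
    rw [← heq] at hmem
    have h0 : y₀ ⬝ᵥ (vecMulVec u v - vecMulVec v u) *ᵥ x₀ = 0 := hmem.2
    rw [dotProduct_vecMulVec_sub_mulVec, huy, hv,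
      hu x₀ (Submodule.mem_span_singleton_self x₀)] at h0
    simp at h0
  have hHker : H = altSubmodule K n ⊓ LinearMap.ker φ := by
    refine Submodule.eq_of_le_of_finrank_le hle ?_
    have := Submodule.finrank_lt_finrank_of_lt hlt
    omega
  have hP : Submodule.span K {x₀, y₀} ≠ ⊤ := by
    intro htop
    classical
    have h := finrank_span_finset_le_card (R := K) ({x₀, y₀} : Finset (Fin n → K))
    rw [Set.finrank, Finset.coe_pair, htop, finrank_top, Module.finrank_fin_fun] at h
    have := Finset.card_le_two (a := x₀) (b := y₀)
    omega
  refine hx₀ (dotProduct_mulVec_self_eq_zero_of_notMem hK hP (fun x hx => ?_) x₀)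
  by_contra hMx
  obtain ⟨y, hy, hyV⟩ := exists_notMem_span_dotProduct_mulVec_eq_zero hM (hti x) hMx
  obtain ⟨v, hvP, hvx⟩ := exists_dotProduct_eq_one_of_notMem hx
  obtain ⟨u, hux, huy⟩ := exists_dotProduct_eq_one_of_notMem hy
  have hmem : vecMulVec u v - vecMulVec v u ∈ H := by
    rw [hHker]
    refine ⟨vecMulVec_sub_mem_altSet u v, ?_⟩
    change y₀ ⬝ᵥ (vecMulVec u v - vecMulVec v u) *ᵥ x₀ = 0
    rw [dotProduct_vecMulVec_sub_mulVec, hvP x₀ (Submodule.subset_span (by simp)),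
      hvP y₀ (Submodule.subset_span (by simp))]
    simp
  have h0 := hyV _ (hHV hmem)
  rw [dotProduct_vecMulVec_sub_mulVec, huy, hvx,
    hux x (Submodule.mem_span_singleton_self x)] at h0
  simp at h0
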